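/- arXiv:math/9807036 — 9 statements merged into one kernel-verified Lean document; each statement's English description precedes it below -/
import Mathlib

section
/- Let $A$ be an $m \times n$ row-Latin rectangle based on $k$. If $m \ge 2n-1$, then $A$ has a transversal. -/
/-- `c` is a transversal of the `m × n` matrix `A`: an injection from columns
to rows such that the selected entries are pairwise distinct. -/
def IsTransversal {m n : ℕ} (A : Fin m → Fin n → ℕ) (c : Fin n → Fin m) : Prop :=
  Function.Injective c ∧ Function.Injective (fun j => A (c j) j)

/-- `c` selects from the columns in `S` entries of `A` in distinct rows and with distinct values. -/
def IsPartialTransversal {ρ κ σ : Type*} (A : ρ → κ → σ) (S : Finset κ) (c : κ → ρ) : Prop :=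
  Set.InjOn c S ∧ Set.InjOn (fun j => A (c j) j) S

namespace IsPartialTransversal

variable {ρ κ σ : Type*} [DecidableEq κ] {A : ρ → κ → σ} {S : Finset κ} {c : κ → ρ}

/-- A partial transversal extends to a new column by an entry from an unused row with an unused
value. -/
theorem update_insert {u : κ} {r : ρ} (hc : IsPartialTransversal A (S.erase u) c)
    (hr : ∀ j ∈ S, j ≠ u → c j ≠ r) (hs : ∀ j ∈ S, j ≠ u → A (c j) j ≠ A r u) :
    IsPartialTransversal A S (Function.update c u r) := by
  obtain ⟨h₁, h₂⟩ := hc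
  constructor
  · intro i hi j hj hij
    by_cases hiu : i = u <;> by_cases hju : j = u
    · rw [hiu, hju]
    · subst hiu
      simp only [Function.update_self, Function.update_of_ne hju] at hij
      exact absurd hij.symm (hr j hj hju)
    · subst hju
      simp only [Function.update_self, Function.update_of_ne hiu] at hij
      exact absurd hij (hr i hi hiu)
    · simp only [Function.update_of_ne hiu, Function.update_of_ne hju] at hij
      exact h₁ (by simpa [hiu] using hi) (by simpa [hju] using hj) hij
  · intro i hi j hj hij
    by_cases hiu : i = u <;> by_cases hju : j = u
    · rw [hiu, hju]
    · subst hiu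
      simp only [Function.update_self, Function.update_of_ne hju] at hij
      exact absurd hij.symm (hs j hj hju)
    · subst hju
      simp only [Function.update_self, Function.update_of_ne hiu] at hij
      exact absurd hij (hs i hi hiu)
    · simp only [Function.update_of_ne hiu, Function.update_of_ne hju] at hij
      exact h₂ (by simpa [hiu] using hi) (by simpa [hju] using hj) hij

/-- If a partial transversal `c` on `S` cannot be extended to the column `j₀`, then every unused
row enlarges the set `T` of columns that can be freed, in exchange for `j₀`, by alternating
replacements within `T` that use only values already selected by `c`. -/
theorem exists_exchangeable_columns [DecidableEq ρ] (hrow : ∀ i, Function.Injective (A i))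
    (hc : IsPartialTransversal A S c) {j₀ : κ} (hj₀ : j₀ ∉ S)
    (hmax : ∀ d, ¬ IsPartialTransversal A (insert j₀ S) d)
    (U : Finset ρ) (hU : ∀ j ∈ S, c j ∉ U) :
    ∃ T ⊆ insert j₀ S, j₀ ∈ T ∧ U.card + 1 ≤ T.card ∧ ∀ v ∈ T, ∃ d : κ → ρ,
      IsPartialTransversal A ((insert j₀ S).erase v) d ∧
      (∀ j ∈ (insert j₀ S).erase v, d j ∈ S.image c ∪ U) ∧
      (∀ j ∈ (insert j₀ S).erase v, ∃ i ∈ S, A (d j) j = A (c i) i) ∧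
      ∀ j ∈ S, j ∉ T → d j = c j := by
  classical
  induction U using Finset.induction_on with
  | empty =>
    refine ⟨{j₀}, by simp, by simp, by simp, fun v hv => ⟨c, ?_⟩⟩
    obtain rfl := Finset.mem_singleton.1 hv
    rw [Finset.erase_insert hj₀]
    exact ⟨hc, fun j hj => by simpa using ⟨j, hj, rfl⟩, fun j hj => ⟨j, hj, rfl⟩,
      fun _ _ _ => rfl⟩
  | insert r U hrU ih =>
    obtain ⟨T, hTS, hjT, hTcard, hT⟩ :=
      ih fun j hj hjU => hU j hj (Finset.mem_insert_of_mem hjU)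
    obtain ⟨y, hy, hyT⟩ : ∃ y ∈ T.image (A r),
        y ∉ (T.erase j₀).image (fun j => A (c j) j) := by
      apply Finset.exists_mem_notMem_of_card_lt_card
      rw [Finset.card_image_of_injective _ (hrow r)]
      exact Finset.card_image_le.trans_lt (Finset.card_erase_lt_of_mem hjT)
    obtain ⟨u, hu, rfl⟩ := Finset.mem_image.1 hy
    obtain ⟨d, hd, hdU, hdA, hdT⟩ := hT u hu
    have hdr : ∀ j ∈ insert j₀ S, j ≠ u → d j ≠ r := by
      rintro j hj hju rfl
      rcases Finset.mem_union.1 (hdU j (Finset.mem_erase.2 ⟨hju, hj⟩)) with h | h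
      · obtain ⟨i, hi, hij⟩ := Finset.mem_image.1 h
        exact hU i hi (hij ▸ Finset.mem_insert_self _ _)
      · exact hrU h
    obtain ⟨v, hvS, hv⟩ : ∃ v ∈ S, A (c v) v = A r u := by
      by_contra! hnot
      refine hmax _ (hd.update_insert hdr fun j hj hju hA => ?_)
      obtain ⟨i, hi, hij⟩ := hdA j (Finset.mem_erase.2 ⟨hju, hj⟩)
      exact hnot i hi (hij ▸ hA)
    have hvT : v ∉ T := fun h => hyT <| Finset.mem_image.2
      ⟨v, Finset.mem_erase.2 ⟨fun h => hj₀ (h ▸ hvS), h⟩, hv⟩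
    have hvu : v ≠ u := fun h => hvT (h ▸ hu)
    have hvS' : v ∈ insert j₀ S := Finset.mem_insert_of_mem hvS
    refine ⟨insert v T, Finset.insert_subset hvS' hTS, Finset.mem_insert_of_mem hjT, ?_, ?_⟩
    · rw [Finset.card_insert_of_notMem hrU, Finset.card_insert_of_notMem hvT]
      lia
    intro w hw
    rcases Finset.mem_insert.1 hw with rfl | hwT
    · refine ⟨Function.update d u r, ?_, fun j hj => ?_, fun j hj => ?_, fun j hj hjT' => ?_⟩
      · refine update_insert ⟨hd.1.mono ?_, hd.2.mono ?_⟩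
          (fun j hj => hdr j (Finset.mem_of_mem_erase hj)) fun j hj hju hA => ?_
        · exact_mod_cast Finset.erase_subset_erase _ (Finset.erase_subset _ _)
        · exact_mod_cast Finset.erase_subset_erase _ (Finset.erase_subset _ _)
        · refine Finset.ne_of_mem_erase hj (hd.2 ?_ ?_ ?_)
          · exact Finset.mem_erase.2 ⟨hju, Finset.mem_of_mem_erase hj⟩
          · exact Finset.mem_erase.2 ⟨hvu, hvS'⟩
          · simp only [hdT w hvS hvT, hA, hv]
      · by_cases hju : j = u
        · simp [hju]
        · rw [Function.update_of_ne hju]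
          exact Finset.union_subset_union_right (Finset.subset_insert _ _)
            (hdU j (Finset.mem_erase.2 ⟨hju, Finset.mem_of_mem_erase hj⟩))
      · by_cases hju : j = u
        · subst hju
          exact ⟨w, hvS, by simp [hv]⟩
        · rw [Function.update_of_ne hju]
          exact hdA j (Finset.mem_erase.2 ⟨hju, Finset.mem_of_mem_erase hj⟩)
      · have hjT : j ∉ T := fun h => hjT' (Finset.mem_insert_of_mem h)
        rw [Function.update_of_ne (show j ≠ u from fun h => hjT (h ▸ hu)), hdT j hj hjT]
    · obtain ⟨e, he, heU, heA, heT⟩ := hT w hwT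
      exact ⟨e, he, fun j hj => Finset.union_subset_union_right (Finset.subset_insert _ _)
        (heU j hj), heA, fun j hj h => heT j hj fun h' => h (Finset.mem_insert_of_mem h')⟩

end IsPartialTransversal

/-- If every row of `A` is injective, then every set `S` of columns has a partial transversal
provided that there are at least `2 * S.card - 1` rows. -/
theorem exists_isPartialTransversal {ρ κ σ : Type*} [Fintype ρ] [Nonempty ρ] {A : ρ → κ → σ}
    (hrow : ∀ i, Function.Injective (A i)) (S : Finset κ) (hS : 2 * S.card - 1 ≤ Fintype.card ρ) :
    ∃ c : κ → ρ, IsPartialTransversal A S c := by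
  classical
  induction S using Finset.induction_on with
  | empty => exact ⟨fun _ => Classical.arbitrary ρ, by simp [IsPartialTransversal]⟩
  | insert j₀ S hj₀ ih =>
    rw [Finset.card_insert_of_notMem hj₀] at hS
    obtain ⟨c, hc⟩ := ih (by lia)
    by_contra! hmax
    obtain ⟨T, hTS, -, hT, -⟩ := hc.exists_exchangeable_columns hrow hj₀ hmax (S.image c)ᶜ
      fun j hj => by simpa using ⟨j, hj, rfl⟩
    have h₁ := Finset.card_le_card hTS
    have h₂ : (S.image c).card ≤ S.card := Finset.card_image_le
    rw [Finset.card_insert_of_notMem hj₀] at h₁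
    rw [Finset.card_compl] at hT
    lia

/-- Drisko's theorem: an `m × n` row-Latin rectangle based on `k`
(entries in `{1, …, k}`, no entry repeated within a row) with `m ≥ 2n - 1`
has a transversal. -/
theorem drisko (m n k : ℕ) (A : Fin m → Fin n → ℕ)
    (hbased : ∀ i j, A i j ∈ Finset.Icc 1 k)
    (hrow : ∀ i, Function.Injective (A i))
    (hm : m ≥ 2 * n - 1) :
    ∃ c : Fin n → Fin m, IsTransversal A c := by
  rcases n.eq_zero_or_pos with rfl | hn
  · exact ⟨Fin.elim0, fun i => i.elim0, fun i => i.elim0⟩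
  · have : NeZero m := ⟨by lia⟩
    obtain ⟨c, h₁, h₂⟩ := exists_isPartialTransversal hrow Finset.univ (by simpa using hm)
    exact ⟨c, by simpa using h₁, by simpa using h₂⟩
end

section
/- Let $A$ be an $m \times n$ matrix with entries in a matroid $M$. Suppose that for each row of $A$ the entries are pairwise distinct and form an independent set of size $n$ in $M$. If $m \ge 2n-1$, then $A$ has an independent transversal. -/
namespace Matroid

variable {ρ κ : Type*}

/-- The cells selected in the columns `D` by the choice of rows `c`. -/
def selectedCells (c : κ → ρ) (D : Set κ) : Set (ρ × κ) :=
  {p | p.2 ∈ D ∧ c p.2 = p.1}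

@[simp]
theorem mem_selectedCells {c : κ → ρ} {D : Set κ} {p : ρ × κ} :
    p ∈ selectedCells c D ↔ p.2 ∈ D ∧ c p.2 = p.1 :=
  Iff.rfl

theorem encard_selectedCells (c : κ → ρ) (D : Set κ) : (selectedCells c D).encard = D.encard := by
  have h : selectedCells c D = (fun j ↦ (c j, j)) '' D := by
    ext ⟨i, j⟩
    simp only [mem_selectedCells, Set.mem_image, Prod.mk.injEq]
    grind
  rw [h, Function.Injective.encard_image]
  exact fun a b hab ↦ congrArg Prod.snd hab

/-- The choice of rows `c` selects in the columns `D` an independent set of cells lying in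
distinct rows, all of which belong to `R`. -/
structure IsPartialTransversal (N : Matroid (ρ × κ)) (c : κ → ρ) (D : Set κ) (R : Set ρ) :
    Prop where
  injOn : Set.InjOn c D
  mapsTo : Set.MapsTo c D R
  indep : N.Indep (selectedCells c D)

/-- Each column in `S` is the uncovered column of some partial transversal of `C` with rows in `R`
which agrees with `c₀` off `S`, and whose part within `S` spans the flat `F`. -/
structure IsExchangeSet (N : Matroid (ρ × κ)) (c₀ : κ → ρ) (C : Set κ) (R : Set ρ) (S : Set κ)
    (F : Set (ρ × κ)) : Prop where
  subset : S ⊆ C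
  exists_transversal : ∀ x ∈ S, ∃ c, Set.EqOn c c₀ (C \ S) ∧
    N.IsPartialTransversal c (C \ {x}) R ∧ N.closure (selectedCells c (S \ {x})) = F

variable {N : Matroid (ρ × κ)} {c₀ : κ → ρ} {C S : Set κ} {R : Set ρ} {F : Set (ρ × κ)}

theorem IsExchangeSet.exists_notMem (h : N.IsExchangeSet c₀ C R S F) (hS : S.Finite)
    (hne : S.Nonempty) {r : ρ} (hr : N.Indep {p | p.1 = r}) : ∃ x ∈ S, (r, x) ∉ F := by
  by_contra! hF
  obtain ⟨x, hx⟩ := hne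
  obtain ⟨c, -, -, hcF⟩ := h.exists_transversal x hx
  have h₁ : N.Indep (selectedCells (fun _ ↦ r) S) := hr.subset fun p hp ↦ hp.2.symm
  have h₂ : selectedCells (fun _ ↦ r) S ⊆ F := by
    rintro ⟨i, j⟩ ⟨hj, hr : r = i⟩
    exact hr ▸ hF j hj
  have h₃ := h₁.encard_le_eRk_of_subset h₂
  rw [← hcF, eRk_closure_eq, encard_selectedCells] at h₃
  have h₄ := h₃.trans (N.eRk_le_encard _)
  rw [encard_selectedCells] at h₄
  exact absurd h₄ (not_le.2 ((hS.subset Set.sdiff_subset).encard_lt_encard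
    (Set.sdiff_singleton_ssubset.2 hx)))

/-- A fresh row either completes a transversal or enlarges the exchange set. -/
theorem IsExchangeSet.extend (h : N.IsExchangeSet c₀ C R S F) (hS : S.Finite)
    (hne : S.Nonempty) {r : ρ} (hr : N.Indep {p | p.1 = r}) (hrR : r ∉ R) :
    (∃ c, N.IsPartialTransversal c C Set.univ) ∨
      ∃ S' F', S ⊂ S' ∧ N.IsExchangeSet c₀ C (insert r R) S' F' := by
  classical
  obtain ⟨x, hx, hxF⟩ := h.exists_notMem hS hne hr
  obtain ⟨c, hc, hcT, hcF⟩ := h.exists_transversal x hx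
  have hxC := h.subset hx
  set I := selectedCells c (C \ {x}) with hI
  have heE : (r, x) ∈ N.E := hr.subset_ground rfl
  have heI : (r, x) ∉ I := by simp [hI]
  have hmaps := hcT.mapsTo
  have hinj := hcT.injOn
  by_cases hecl : (r, x) ∉ N.closure I
  · left
    refine ⟨Function.update c x r, ?_, Set.mapsTo_univ _ _, ?_⟩
    · intro a ha b hb hab
      simp only [Set.InjOn, Set.MapsTo, Set.mem_sdiff, Set.mem_singleton_iff] at hinj hmaps
      grind [Function.update_apply]
    · refine (((hcT.indep.notMem_closure_iff heE).1 hecl).1).subset ?_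
      rintro ⟨i, j⟩ ⟨hj, hij⟩
      by_cases hjx : j = x <;> simp_all
  right
  rw [not_not] at hecl
  have hK := hcT.indep.fundCircuit_isCircuit hecl heI
  have hKI := N.fundCircuit_subset_insert (r, x) I
  set K := N.fundCircuit (r, x) I
  have heK : (r, x) ∈ K := N.mem_fundCircuit _ _
  set D : Set κ := {y | y ∈ C \ S ∧ (c y, y) ∈ K} with hD
  -- The span within `S ∪ D` does not depend on the partial transversal.
  have hspan : ∀ (x' : κ) (c' : κ → ρ), x' ∈ S → Set.EqOn c' c₀ (C \ S) →
      N.closure (selectedCells c' (S \ {x'})) = F →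
      N.closure (selectedCells c' ((S ∪ D) \ {x'})) = N.closure (F ∪ selectedCells c₀ D) := by
    intro x' c' hx' hc' hF'
    rw [← hF', closure_union_closure_left_eq]
    congr 1
    ext ⟨i, j⟩
    have := @hc' j
    simp only [mem_selectedCells, Set.mem_union, Set.mem_sdiff, Set.mem_singleton_iff, hD,
      Set.mem_ofPred_eq] at this ⊢
    grind
  have hDne : ∃ y, y ∈ D := by
    by_contra! hDe
    refine hxF (hcF ▸ N.closure_subset_closure ?_
      (hK.mem_closure_sdiff_singleton_of_mem heK))
    rintro ⟨i, j⟩ ⟨hp, hne⟩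
    have h₁ := hKI hp
    have h₂ := hDe j
    simp only [hI, hD, Set.mem_insert_iff, mem_selectedCells, Set.mem_sdiff, Set.mem_singleton_iff,
      Set.mem_ofPred_eq] at h₁ h₂ hne ⊢
    grind
  obtain ⟨y₀, hy₀⟩ := hDne
  refine ⟨S ∪ D, N.closure (F ∪ selectedCells c₀ D), ?_, ?_, ?_⟩
  · exact (Set.ssubset_iff_of_subset Set.subset_union_left).2 ⟨y₀, Or.inr hy₀, hy₀.1.2⟩
  · exact Set.union_subset h.subset fun y hy ↦ hy.1.1
  rintro y (hy | hy)
  · obtain ⟨c', hc', hcT', hcF'⟩ := h.exists_transversal y hy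
    refine ⟨c', hc'.mono (Set.sdiff_subset_sdiff_right Set.subset_union_left),
      ⟨hcT'.injOn, hcT'.mapsTo.mono_right (Set.subset_insert _ _), hcT'.indep⟩,
      hspan y c' hy hc' hcF'⟩
  · have hyx : y ≠ x := fun hyx ↦ hy.1.2 (hyx ▸ hx)
    refine ⟨Function.update c x r, ?_, ⟨?_, ?_, ?_⟩, ?_⟩
    · intro j hj
      have : j ≠ x := fun hjx ↦ hj.2 (Or.inl (hjx ▸ hx))
      rw [Function.update_of_ne this]
      exact hc ⟨hj.1, fun hjS ↦ hj.2 (Or.inl hjS)⟩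
    · intro a ha b hb hab
      simp only [Set.InjOn, Set.MapsTo, Set.mem_sdiff, Set.mem_singleton_iff] at hinj hmaps ha hb
      grind [Function.update_apply]
    · intro a ha
      simp only [Set.MapsTo, Set.mem_sdiff, Set.mem_singleton_iff, Set.mem_insert_iff]
        at hmaps ha ⊢
      grind [Function.update_apply]
    · refine ((hcT.indep.mem_fundCircuit_iff hecl heI).1 hy.2).subset ?_
      rintro ⟨i, j⟩ hp
      simp only [Set.mem_insert_iff, mem_selectedCells, Set.mem_sdiff, Set.mem_singleton_iff,
        Prod.mk.injEq] at hp ⊢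
      grind [Function.update_apply]
    · rw [← hspan x c hx hc hcF]
      have hcE : selectedCells c ((S ∪ D) \ {x}) ⊆ I := fun p hp ↦
        ⟨⟨hp.1.1.elim (fun h' ↦ h.subset h') fun h' ↦ h'.1.1, hp.1.2⟩, hp.2⟩
      have hIE := hcT.indep.subset_ground
      have hKsub : ∀ p ∈ K, p = (r, x) ∨ p ∈ selectedCells c ((S ∪ D) \ {x}) := by
        rintro ⟨i, j⟩ hp
        have h₁ := hKI hp
        simp only [hI, hD, Set.mem_insert_iff, mem_selectedCells, Set.mem_sdiff,
          Set.mem_singleton_iff, Set.mem_union, Set.mem_ofPred_eq, Prod.mk.injEq] at h₁ ⊢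
        grind
      have hupd : ∀ p, p ∈ selectedCells (Function.update c x r) ((S ∪ D) \ {y}) ↔
          p = (r, x) ∨ (p ∈ selectedCells c ((S ∪ D) \ {x}) ∧ p ≠ (c y, y)) := by
        rintro ⟨i, j⟩
        simp only [mem_selectedCells, Set.mem_sdiff, Set.mem_singleton_iff, Set.mem_union,
          Prod.mk.injEq, ne_eq]
        grind [Function.update_apply]
      refine subset_antisymm (closure_subset_closure_of_subset_closure ?_)
        (closure_subset_closure_of_subset_closure ?_)
      · intro p hp
        obtain rfl | ⟨hp, -⟩ := (hupd p).1 hp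
        · refine N.closure_subset_closure ?_ (hK.mem_closure_sdiff_singleton_of_mem heK)
          exact fun q hq ↦ (hKsub q hq.1).resolve_left hq.2
        · exact N.mem_closure_of_mem' hp (hIE (hcE hp))
      · intro p hp
        by_cases hpy : p = (c y, y)
        · subst hpy
          refine N.closure_subset_closure ?_ (hK.mem_closure_sdiff_singleton_of_mem hy.2)
          exact fun q hq ↦ (hupd q).2 ((hKsub q hq.1).imp_right fun h' ↦ ⟨h', hq.2⟩)
        · exact N.mem_closure_of_mem' ((hupd p).2 (Or.inr ⟨hp, hpy⟩)) (hIE (hcE hp))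

/-- A partial transversal can be extended by one column when there are enough rows. -/
theorem IsPartialTransversal.exists_insert [Finite ρ] (hrow : ∀ r, N.Indep {p | p.1 = r})
    (hC : C.Finite) {x : κ} (hx : x ∉ C) (h : N.IsPartialTransversal c₀ C Set.univ)
    (hcard : 2 * C.ncard < Nat.card ρ) :
    ∃ c, N.IsPartialTransversal c (insert x C) Set.univ := by
  by_contra hno
  have key : ∀ t ≤ C.ncard + 1, ∃ R S F, N.IsExchangeSet c₀ (insert x C) R S F ∧
      R.ncard ≤ C.ncard + t ∧ t < S.ncard := by
    intro t
    induction t with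
    | zero =>
      refine fun _ ↦ ⟨c₀ '' C, {x}, N.closure ∅, ⟨by simp, ?_⟩, Set.ncard_image_le hC, by simp⟩
      rintro _ rfl
      refine ⟨c₀, fun _ _ ↦ rfl, ?_, ?_⟩
      · rw [Set.insert_sdiff_self_of_notMem hx]
        exact ⟨h.injOn, Set.mapsTo_image _ _, h.indep⟩
      · congr 1
        ext p
        simp
    | succ t ih =>
      intro ht
      obtain ⟨R, S, F, hE, hR, hS⟩ := ih (by omega)
      obtain ⟨r, hr⟩ : ∃ r, r ∉ R := by
        by_contra! hall
        rw [Set.eq_univ_of_forall hall, Set.ncard_univ] at hR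
        omega
      obtain hT | ⟨S', F', hS', hE'⟩ := hE.extend ((hC.insert x).subset hE.subset)
        (Set.nonempty_of_ncard_ne_zero (by omega)) (hrow r) hr
      · exact absurd hT hno
      · refine ⟨insert r R, S', F', hE', (Set.ncard_insert_le r R).trans (by omega), ?_⟩
        have := Set.ncard_lt_ncard hS' ((hC.insert x).subset hE'.subset)
        omega
  obtain ⟨R, S, F, hE, -, hS⟩ := key _ le_rfl
  have h₁ := Set.ncard_le_ncard hE.subset (hC.insert x)
  rw [Set.ncard_insert_of_notMem hx hC] at h₁
  omega

theorem exists_isPartialTransversal_univ [Finite ρ] [Finite κ]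
    (hrow : ∀ r, N.Indep {p | p.1 = r}) (hcard : 2 * Nat.card κ - 1 ≤ Nat.card ρ)
    (c₀ : κ → ρ) : ∃ c, N.IsPartialTransversal c Set.univ Set.univ := by
  refine Set.Finite.induction_on (motive := fun C _ ↦ ∃ c, N.IsPartialTransversal c C Set.univ)
    _ Set.finite_univ ⟨c₀, by simp, by simp, ?_⟩ ?_
  · convert N.empty_indep
    ext p
    simp
  · rintro x C hx hC ⟨c, hc⟩
    refine hc.exists_insert hrow hC hx ?_
    have h₁ := Set.ncard_le_card (insert x C)
    rw [Set.ncard_insert_of_notMem hx hC] at h₁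
    omega

end Matroid


/-- Main theorem: if `A` is an `m × n` matrix with entries in a matroid `M`
such that each row has pairwise distinct entries forming an independent set
(of size `n`), and `m ≥ 2n - 1`, then `A` has an independent transversal:
an injection `c` from columns to rows whose selected entries are pairwise
distinct and form an independent set of `M`. -/
theorem matroid_row_latin_independent_transversal {α : Type*} (M : Matroid α)
    (m n : ℕ) (A : Fin m → Fin n → α)
    (hrow_inj : ∀ i, Function.Injective (A i))
    (hrow_ind : ∀ i, M.Indep (Set.range (A i)))
    (hm : m ≥ 2 * n - 1) :
    ∃ c : Fin n → Fin m, Function.Injective c ∧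
      Function.Injective (fun j => A (c j) j) ∧
      M.Indep (Set.range (fun j => A (c j) j)) := by
  obtain rfl | hn := Nat.eq_zero_or_pos n
  · exact ⟨Fin.elim0, fun a ↦ a.elim0, fun a ↦ a.elim0, by simp⟩
  have hrow (r : Fin m) : (M.comap fun p : Fin m × Fin n ↦ A p.1 p.2).Indep {p | p.1 = r} := by
    refine Matroid.comap_indep_iff.2 ⟨(hrow_ind r).subset ?_, ?_⟩
    · rintro _ ⟨⟨i, j⟩, rfl, rfl⟩
      exact ⟨j, rfl⟩
    · rintro ⟨i, j⟩ rfl ⟨i', j'⟩ rfl h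
      exact Prod.ext rfl (hrow_inj _ h)
  obtain ⟨c, hc⟩ := Matroid.exists_isPartialTransversal_univ hrow (by simpa using hm)
    fun _ ↦ ⟨0, by omega⟩
  obtain ⟨hind, hinj⟩ := Matroid.comap_indep_iff.1 hc.indep
  refine ⟨c, Set.injOn_univ.1 hc.injOn, fun a b hab ↦ ?_, hind.subset ?_⟩
  · exact congrArg Prod.snd (@hinj (c a, a) (by simp) (c b, b) (by simp) hab)
  · rintro _ ⟨j, rfl⟩
    exact ⟨(c j, j), by simp, rfl⟩
end

section
/- For every integer $n \ge 2$, the matrix $R_{2n-2,n}$ has no transversal. -/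
/-- The matrix `R m n`: its first `m - (n-1)` rows are `(1, 2, …, n)` and its
remaining `n - 1` rows are `(2, 3, …, n, 1)` (rows and columns `0`-indexed). -/
def Rmat (m n : ℕ) : Fin m → Fin n → ℕ := fun i j =>
  if (i : ℕ) < m - (n - 1) then (j : ℕ) + 1
  else if (j : ℕ) + 2 ≤ n then (j : ℕ) + 2 else 1

/-- An injection from `n` columns to `2 * n - 2` rows uses both a row below `n - 1` and a row from
`n - 1` on. -/
lemma exists_lt_and_exists_le_of_injective {n : ℕ} (hn : 2 ≤ n) {c : Fin n → Fin (2 * n - 2)}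
    (hc : Function.Injective c) :
    (∃ j, (c j : ℕ) < n - 1) ∧ ∃ j, n - 1 ≤ (c j : ℕ) := by
  constructor
  · by_contra! h
    have hinj : Function.Injective
        (fun j => (⟨(c j : ℕ) - (n - 1), by have := (c j).2; omega⟩ : Fin (n - 1))) := by
      intro a b hab
      have hab' := Fin.mk.inj hab
      have ha := h a
      have hb := h b
      exact hc (Fin.ext (by omega))
    have := Fintype.card_le_of_injective _ hinj
    simp only [Fintype.card_fin] at this
    omega
  · by_contra! h
    have hinj : Function.Injective (fun j => (⟨(c j : ℕ), h j⟩ : Fin (n - 1))) :=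
      fun a b hab => hc (Fin.ext (Fin.mk.inj hab))
    have := Fintype.card_le_of_injective _ hinj
    simp only [Fintype.card_fin] at this
    omega

/-- For every `n ≥ 2`, the matrix `R (2n-2) n` has no transversal. -/
theorem Rmat_two_n_sub_two_no_transversal (n : ℕ) (hn : 2 ≤ n) :
    ¬ ∃ c : Fin n → Fin (2 * n - 2), IsTransversal (Rmat (2 * n - 2) n) c := by
  rintro ⟨c, hc, hval⟩
  obtain ⟨⟨a, ha⟩, ⟨b, hb⟩⟩ := exists_lt_and_exists_le_of_injective hn hc
  have hm : 2 * n - 2 - (n - 1) = n - 1 := by omega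
  -- A shifted row in one column forces a shifted row in the cyclically next column.
  have hsucc : ∀ j (hj : j + 1 < n), n - 1 ≤ (c ⟨j, by omega⟩ : ℕ) →
      n - 1 ≤ (c ⟨j + 1, hj⟩ : ℕ) := by
    intro j hj h
    by_contra! h'
    have heq : (⟨j, by omega⟩ : Fin n) = ⟨j + 1, hj⟩ := hval (by
      simp only [Rmat, hm, if_neg h.not_gt, if_pos h']
      rw [if_pos (by omega)])
    have := Fin.mk.inj heq
    omega
  have hwrap : n - 1 ≤ (c ⟨n - 1, by omega⟩ : ℕ) → n - 1 ≤ (c ⟨0, by omega⟩ : ℕ) := by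
    intro h
    by_contra! h'
    have heq : (⟨n - 1, by omega⟩ : Fin n) = ⟨0, by omega⟩ := hval (by
      simp only [Rmat, hm, if_neg h.not_gt, if_pos h']
      rw [if_neg (by omega)])
    have := Fin.mk.inj heq
    omega
  have hprop : ∀ i (hi : i < n), n - 1 ≤ (c ⟨i, hi⟩ : ℕ) → ∀ j, i ≤ j → ∀ hj : j < n,
      n - 1 ≤ (c ⟨j, hj⟩ : ℕ) := by
    intro i hi h j hij
    induction j, hij using Nat.le_induction with
    | base => exact fun _ => h
    | succ k _ ih => exact fun hk => hsucc k hk (ih (by omega))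
  have hlast := hprop b b.2 hb (n - 1) (by have := b.2; omega) (by omega)
  exact ha.not_ge (hprop 0 (by omega) (hwrap hlast) a (Nat.zero_le _) a.2)
end

section
/- For all integers $m, n$ with $n \ge 1$ and $m \ge 2n-1$, the matrix $R_{m,n}$ has $m-(n-1)$ pairwise disjoint transversals. -/
/-- Cyclic shifts by distinct amounts less than `k` differ modulo `k`. -/
theorem add_mod_injective {k a b s : ℕ} (ha : a < k) (hb : b < k)
    (h : (s + a) % k = (s + b) % k) : a = b :=
  Nat.ModEq.eq_of_lt_of_lt (Nat.ModEq.add_left_cancel' s h) ha hb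

/-- For all `n ≥ 1` and `m ≥ 2n - 1`, the matrix `R m n` has `m - (n-1)`
pairwise disjoint transversals (disjoint: sharing no cell). -/
theorem Rmat_disjoint_transversals (m n : ℕ) (hn : 1 ≤ n) (hm : 2 * n - 1 ≤ m) :
    ∃ c : Fin (m - (n - 1)) → Fin n → Fin m,
      (∀ t, IsTransversal (Rmat m n) (c t)) ∧
      (∀ t t', t ≠ t' → ∀ j, c t j ≠ c t' j) := by
  have hk : n ≤ m - (n - 1) := by omega
  have hmod (x : ℕ) : x % (m - (n - 1)) < m - (n - 1) := Nat.mod_lt _ (by omega)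
  refine ⟨fun t j => ⟨(t + j) % (m - (n - 1)), (hmod _).trans_le (Nat.sub_le _ _)⟩,
    fun t => ⟨fun a b h => ?_, fun a b h => ?_⟩, fun t t' ht j h => ht ?_⟩
  · exact Fin.ext (add_mod_injective (a.2.trans_le hk) (b.2.trans_le hk) (congrArg Fin.val h))
  · simp only [Rmat, hmod, if_true] at h
    exact Fin.ext (Nat.succ_injective h)
  · refine Fin.ext (add_mod_injective (s := j) t.2 t'.2 ?_)
    simpa only [Nat.add_comm] using congrArg Fin.val h
end

section
/- For all integers $m, n$ with $n \ge 1$ and $m \ge 2n-1$, there exist $n$ rows of $R_{m,n}$ that together are the union of $n$ transversals. -/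
/-- There exist `n` rows of `A` (given by an injection `rows`) that together are
the union of `n` transversals: there are `n` pairwise disjoint transversals,
each using only those rows, whose cells together are exactly all the cells of
those rows. -/
def ExistsNRowsUnionOfNTransversals {m n : ℕ} (A : Fin m → Fin n → ℕ) : Prop :=
  ∃ (rows : Fin n → Fin m) (c : Fin n → Fin n → Fin m),
    Function.Injective rows ∧
    (∀ t, IsTransversal A (c t)) ∧
    (∀ t j, c t j ∈ Set.range rows) ∧
    (∀ t t', t ≠ t' → ∀ j, c t j ≠ c t' j) ∧
    (∀ i j, i ∈ Set.range rows → ∃ t, c t j = i)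

/-- If `n` rows of `A` are all equal to one row `v` with distinct entries, then those rows
are together the union of the `n` cyclic diagonals, which are transversals. -/
theorem existsNRowsUnionOfNTransversals_of_rows_eq {m n : ℕ} {A : Fin m → Fin n → ℕ}
    (rows : Fin n → Fin m) (hrows : Function.Injective rows) (v : Fin n → ℕ)
    (hv : Function.Injective v) (hA : ∀ i, A (rows i) = v) :
    ExistsNRowsUnionOfNTransversals A := by
  refine ⟨rows, fun t j => rows (t + j), hrows, fun t => ⟨?_, ?_⟩,
    fun t j => Set.mem_range_self _, ?_, ?_⟩
  · intro j j' h
    have : NeZero n := ⟨j.pos.ne'⟩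
    exact add_left_cancel (hrows h)
  · simpa only [hA] using hv
  · intro t t' htt' j h
    have : NeZero n := ⟨j.pos.ne'⟩
    exact htt' (add_right_cancel (hrows h))
  · rintro _ j ⟨k, rfl⟩
    have : NeZero n := ⟨j.pos.ne'⟩
    exact ⟨k - j, congrArg rows (sub_add_cancel k j)⟩

/-- For all `n ≥ 1` and `m ≥ 2n - 1`, there exist `n` rows of `R m n` that
together are the union of `n` transversals. -/
theorem Rmat_n_rows_union_of_n_transversals (m n : ℕ) (hn : 1 ≤ n) (hm : 2 * n - 1 ≤ m) :
    ExistsNRowsUnionOfNTransversals (Rmat m n) := by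
  refine existsNRowsUnionOfNTransversals_of_rows_eq (Fin.castLE (by omega))
    (Fin.castLE_injective _) (fun j => j + 1) (fun j j' h => by simpa [Fin.ext_iff] using h) ?_
  intro i
  funext j
  have hi : (i : ℕ) < m - (n - 1) := by omega
  simp [Rmat, hi]
end

section
/- For every integer $n \ge 2$, there do not exist $n$ rows of the matrix $T_n$ that together are the union of $n$ transversals. -/
/-- The `(n² - 1) × n` matrix `T n`: its rows consist of `n - 1` copies of each
of the `n + 1` cyclic shifts of `(1, 2, …, n+1)` truncated to their first `n`
entries.  With `0`-indexed rows and columns, row `i` lies in block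
`s = i / (n - 1)` and its `j`-th entry is the representative of `s + j + 1`
modulo `n + 1` in `{1, …, n+1}`. -/
def Tmat (n : ℕ) : Fin (n ^ 2 - 1) → Fin n → ℕ := fun i j =>
  ((i : ℕ) / (n - 1) + (j : ℕ)) % (n + 1) + 1

/-- An injective family of `n` elements in an additive group of order `n + 1` misses the difference
between the sum of all the group elements and the sum of the family. -/
theorem ne_sum_univ_sub_sum_of_injective {n : ℕ} {G : Type*} [AddCommGroup G] [Fintype G]
    (hG : Fintype.card G = n + 1) {g : Fin n → G} (hg : Function.Injective g) (j : Fin n) :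
    g j ≠ ∑ x, x - ∑ k, g k := by
  classical
  have hcard : ((Finset.univ.image g)ᶜ).card = 1 := by
    rw [Finset.card_compl, Finset.card_image_of_injective _ hg, hG, Finset.card_univ,
      Fintype.card_fin]
    omega
  obtain ⟨m, hm⟩ := Finset.card_eq_one.mp hcard
  have hsum : ∑ k, g k + m = ∑ x, x := by
    rw [← Finset.sum_add_sum_compl (Finset.univ.image g) (fun x => x), hm, Finset.sum_singleton,
      Finset.sum_image hg.injOn]
  have hmem : m ∈ (Finset.univ.image g)ᶜ := by simp [hm]
  rw [← hsum, add_sub_cancel_left]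
  rintro rfl
  simp at hmem

/-- If `b + j ≠ M` modulo `n + 1` for all `j < n`, then `b = M + 1`. -/
theorem ZMod.eq_add_one_of_forall_add_ne {n : ℕ} {b M : ZMod (n + 1)}
    (h : ∀ j : Fin n, b + ((j : ℕ) : ZMod (n + 1)) ≠ M) : b = M + 1 := by
  have hlt := ZMod.val_lt (M - b)
  have hval : (M - b).val = n := by
    by_contra hne
    refine h ⟨(M - b).val, by omega⟩ ?_
    simp
  have hcast : M - b = (n : ZMod (n + 1)) := by
    simpa only [ZMod.natCast_zmod_val] using congrArg (Nat.cast (R := ZMod (n + 1))) hval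
  have hzero : (n : ZMod (n + 1)) + 1 = 0 := by exact_mod_cast ZMod.natCast_self (n + 1)
  linear_combination -hzero - hcast

/-- For every `n ≥ 2`, no `n` rows of `T n` are together the union of `n`
transversals. -/
theorem Tmat_no_n_rows_union_of_n_transversals (n : ℕ) (hn : 2 ≤ n) :
    ¬ ExistsNRowsUnionOfNTransversals (Tmat n) := by
  rintro ⟨rows, c, hrows, htrans, hrange, -, hcover⟩
  let block : Fin (n ^ 2 - 1) → ℕ := fun i => (i : ℕ) / (n - 1)
  have hblock (i) : block i < n + 1 := by
    have hfactor : n ^ 2 - 1 = (n + 1) * (n - 1) := by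
      simpa using Nat.sq_sub_sq n 1
    exact Nat.div_lt_of_lt_mul (by rw [mul_comm, ← hfactor]; exact i.2)
  have hinj (t) : Function.Injective
      (fun j : Fin n => (block (c t j) : ZMod (n + 1)) + ((j : ℕ) : ZMod (n + 1))) := by
    intro j k hjk
    refine (htrans t).2 ?_
    have hmod := (ZMod.natCast_eq_natCast_iff' (block (c t j) + j) (block (c t k) + k) (n + 1)).mp
      (by push_cast; exact hjk)
    exact congrArg (· + 1) hmod
  have hsum (t) : ∑ j, (block (c t j) : ZMod (n + 1)) = ∑ r, (block (rows r) : ZMod (n + 1)) := by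
    choose e he using hrange t
    have he_inj : Function.Injective e := fun j k hjk =>
      (htrans t).1 (by rw [← he j, ← he k, hjk])
    rw [← (Finite.injective_iff_bijective.mp he_inj).sum_comp
      (fun r => (block (rows r) : ZMod (n + 1)))]
    simp only [he]
  have hconst (r) : (block (rows r) : ZMod (n + 1)) =
      ∑ x, x - (∑ r, (block (rows r) : ZMod (n + 1)) + ∑ j : Fin n, ((j : ℕ) : ZMod (n + 1)))
        + 1 := by
    refine ZMod.eq_add_one_of_forall_add_ne fun j => ?_
    obtain ⟨t, ht⟩ := hcover (rows r) j ⟨r, rfl⟩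
    have hne := ne_sum_univ_sub_sum_of_injective (ZMod.card (n + 1)) (hinj t) j
    simpa only [Finset.sum_add_distrib, hsum, ht] using hne
  have heq (r r') : block (rows r) = block (rows r') := by
    have hmod := (ZMod.natCast_eq_natCast_iff' _ _ _).mp ((hconst r).trans (hconst r').symm)
    rwa [Nat.mod_eq_of_lt (hblock _), Nat.mod_eq_of_lt (hblock _)] at hmod
  have hres : Function.Injective
      (fun r => (⟨rows r % (n - 1), Nat.mod_lt _ (by omega)⟩ : Fin (n - 1))) := by
    intro r r' h
    refine hrows (Fin.ext ?_)
    rw [← Nat.div_add_mod (rows r : ℕ) (n - 1), ← Nat.div_add_mod (rows r' : ℕ) (n - 1),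
      Fin.mk.inj h]
    exact congrArg (fun q => (n - 1) * q + _) (heq r r')
  have hle := Fintype.card_le_of_injective _ hres
  simp only [Fintype.card_fin] at hle
  omega
end

section
/- The $4 \times 3$ matrix with rows $(1,2,3)$, $(1,2,3)$, $(2,1,3)$, $(3,2,1)$ does not have $3$ pairwise disjoint transversals. -/
/-- The `4 × 3` matrix with rows `(1,2,3)`, `(1,2,3)`, `(2,1,3)`, `(3,2,1)`. -/
def A7 : Fin 4 → Fin 3 → ℕ :=
  ![![1, 2, 3], ![1, 2, 3], ![2, 1, 3], ![3, 2, 1]]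

/-- Every transversal of `A7` meets the first column in one of the two equal rows `(1,2,3)`. -/
theorem IsTransversal.A7_apply_zero_lt_two {c : Fin 3 → Fin 4} (hc : IsTransversal A7 c) :
    c 0 < 2 := by
  have key : ∀ x y z : Fin 4, x ≠ y → x ≠ z → A7 x 0 ≠ A7 y 1 → A7 x 0 ≠ A7 z 2 →
      A7 y 1 ≠ A7 z 2 → x < 2 := by decide
  exact key (c 0) (c 1) (c 2) (hc.1.ne (by decide)) (hc.1.ne (by decide))
    (hc.2.ne (a₁ := 0) (a₂ := 1) (by decide)) (hc.2.ne (a₁ := 0) (a₂ := 2) (by decide))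
    (hc.2.ne (a₁ := 1) (a₂ := 2) (by decide))

/-- The matrix `A7` does not have `3` pairwise disjoint transversals. -/
theorem A7_no_three_disjoint_transversals :
    ¬ ∃ c : Fin 3 → Fin 3 → Fin 4,
      (∀ t, IsTransversal A7 (c t)) ∧
      (∀ t t', t ≠ t' → ∀ j, c t j ≠ c t' j) := by
  rintro ⟨c, hc, hd⟩
  have h₀ := (hc 0).A7_apply_zero_lt_two
  have h₁ := (hc 1).A7_apply_zero_lt_two
  have h₂ := (hc 2).A7_apply_zero_lt_two
  have h₀₁ := hd 0 1 (by decide) 0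
  have h₀₂ := hd 0 2 (by decide) 0
  have h₁₂ := hd 1 2 (by decide) 0
  omega
end

section
/- For the $8 \times 3$ matrix with rows $(1,2,3)$, $(1,2,3)$, $(2,3,1)$, $(2,3,1)$, $(1,3,2)$, $(1,3,2)$, $(2,1,3)$, $(2,1,3)$, there do not exist $3$ rows that together are the union of $3$ transversals. -/
/-- The `8 × 3` matrix with rows `(1,2,3)`, `(1,2,3)`, `(2,3,1)`, `(2,3,1)`,
`(1,3,2)`, `(1,3,2)`, `(2,1,3)`, `(2,1,3)`. -/
def A9 : Fin 8 → Fin 3 → ℕ :=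
  ![![1, 2, 3], ![1, 2, 3], ![2, 3, 1], ![2, 3, 1],
    ![1, 3, 2], ![1, 3, 2], ![2, 1, 3], ![2, 1, 3]]

/-- The two ways of splitting three rows `a`, `b`, `d` of `A9` into disjoint systems of
representatives, by cyclic or by anticyclic diagonals, both contain a repeated value. -/
theorem A9_diagonals_not_all_distinct : ∀ a b d : Fin 8, a ≠ b → a ≠ d → b ≠ d →
    ¬ (∀ x ∈ [(a, b, d), (b, d, a), (d, a, b)], [A9 x.1 0, A9 x.2.1 1, A9 x.2.2 2].Nodup) ∧
    ¬ (∀ x ∈ [(a, d, b), (b, a, d), (d, b, a)], [A9 x.1 0, A9 x.2.1 1, A9 x.2.2 2].Nodup) := by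
  decide +kernel

/-- No `3` rows of `A9` are together the union of `3` transversals. -/
theorem A9_no_three_rows_union_of_three_transversals :
    ¬ ExistsNRowsUnionOfNTransversals A9 := by
  rintro ⟨rows, c, -, htrans, hrange, hdisj, hcover⟩
  have hinj (t : Fin 3) : c t 0 ≠ c t 1 ∧ c t 0 ≠ c t 2 ∧ c t 1 ≠ c t 2 :=
    ⟨(htrans t).1.ne (by decide), (htrans t).1.ne (by decide), (htrans t).1.ne (by decide)⟩
  have hval (t : Fin 3) : [A9 (c t 0) 0, A9 (c t 1) 1, A9 (c t 2) 2].Nodup := by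
    have h01 := (htrans t).2.ne (show (0 : Fin 3) ≠ 1 by decide)
    have h02 := (htrans t).2.ne (show (0 : Fin 3) ≠ 2 by decide)
    have h12 := (htrans t).2.ne (show (1 : Fin 3) ≠ 2 by decide)
    simp_all
  have hmem (t j : Fin 3) : c t j = c 0 0 ∨ c t j = c 1 0 ∨ c t j = c 2 0 := by
    obtain ⟨s, hs⟩ := hcover _ 0 (hrange t j)
    fin_cases s <;> simp_all
  have hcol (j : Fin 3) : c 0 j ≠ c 1 j ∧ c 0 j ≠ c 2 j ∧ c 1 j ≠ c 2 j :=
    ⟨hdisj _ _ (by decide) j, hdisj _ _ (by decide) j, hdisj _ _ (by decide) j⟩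
  have hdiag :
      (c 0 1 = c 1 0 ∧ c 0 2 = c 2 0 ∧ c 1 1 = c 2 0 ∧ c 1 2 = c 0 0 ∧
        c 2 1 = c 0 0 ∧ c 2 2 = c 1 0) ∨
      (c 0 1 = c 2 0 ∧ c 0 2 = c 1 0 ∧ c 1 1 = c 0 0 ∧ c 1 2 = c 2 0 ∧
        c 2 1 = c 1 0 ∧ c 2 2 = c 0 0) := by
    have := hinj 0; have := hinj 1; have := hinj 2
    have := hcol 0; have := hcol 1; have := hcol 2
    have := hmem 0 1; have := hmem 0 2; have := hmem 1 1
    have := hmem 1 2; have := hmem 2 1; have := hmem 2 2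
    clear hinj hcol hmem hval htrans hrange hdisj hcover
    grind
  obtain ⟨hab, had, hbd⟩ := hcol 0
  obtain ⟨hcyc, hanti⟩ := A9_diagonals_not_all_distinct _ _ _ hab had hbd
  have h0 := hval 0
  have h1 := hval 1
  have h2 := hval 2
  rcases hdiag with ⟨e01, e02, e11, e12, e21, e22⟩ | ⟨e01, e02, e11, e12, e21, e22⟩ <;>
    rw [e01, e02] at h0 <;> rw [e11, e12] at h1 <;> rw [e21, e22] at h2
  · exact hcyc (List.forall_mem_cons.2
      ⟨h0, List.forall_mem_cons.2 ⟨h1, List.forall_mem_singleton.2 h2⟩⟩)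
  · exact hanti (List.forall_mem_cons.2
      ⟨h0, List.forall_mem_cons.2 ⟨h1, List.forall_mem_singleton.2 h2⟩⟩)
end

section
/- Let $M$ be a matroid, let $P$ be an independent set in $M$, and let $b_1, b_2 \notin P$ be distinct elements such that $\{b_1, b_2\}$ is independent. Suppose both $P \cup \{b_1\}$ and $P \cup \{b_2\}$ are dependent. Then there exist distinct elements $c_1, c_2 \in P$ such that $(P \cup \{b_1\}) \setminus \{c_1\}$ and $(P \cup \{b_2\}) \setminus \{c_2\}$ are both independent. -/
open Set

/-- If a nonloop `b` lies in the closure of an independent set `P` but not in `P`, then its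
fundamental circuit with respect to `P` meets `P`. -/
theorem Matroid.Indep.exists_mem_fundCircuit {α : Type*} {M : Matroid α} {P : Set α} {b : α}
    (hP : M.Indep P) (hbP : b ∉ P) (hb : M.Indep {b}) (hd : b ∈ M.closure P) :
    ∃ c ∈ P, c ∈ M.fundCircuit b P := by
  by_contra! h
  refine (hP.fundCircuit_isCircuit hd hbP).not_indep (hb.subset fun x hx => ?_)
  rcases M.fundCircuit_subset_insert b P hx with rfl | hxP
  · rfl
  · exact absurd hx (h x hxP)

/-- Let `P` be an independent set of a matroid `M` and let `b₁ ≠ b₂` be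
elements outside `P` with `{b₁, b₂}` independent.  If both `P ∪ {b₁}` and
`P ∪ {b₂}` are dependent, then there are distinct `c₁, c₂ ∈ P` such that
`(P ∪ {b₁}) \ {c₁}` and `(P ∪ {b₂}) \ {c₂}` are both independent. -/
theorem matroid_two_exchange {α : Type*} (M : Matroid α) (P : Set α)
    (b₁ b₂ : α) (hP : M.Indep P) (hb₁ : b₁ ∉ P) (hb₂ : b₂ ∉ P) (hne : b₁ ≠ b₂)
    (hb : M.Indep {b₁, b₂})
    (hd₁ : ¬ M.Indep (P ∪ {b₁})) (hd₂ : ¬ M.Indep (P ∪ {b₂})) :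
    ∃ c₁ ∈ P, ∃ c₂ ∈ P, c₁ ≠ c₂ ∧
      M.Indep ((P ∪ {b₁}) \ {c₁}) ∧ M.Indep ((P ∪ {b₂}) \ {c₂}) := by
  have mem_closure {b : α} (hbE : b ∈ M.E) (hbP : b ∉ P) (hd : ¬ M.Indep (P ∪ {b})) :
      b ∈ M.closure P := by
    rw [hP.mem_closure_iff_of_notMem hbP, Matroid.dep_iff, ← union_singleton]
    exact ⟨hd, union_subset hP.subset_ground (singleton_subset_iff.2 hbE)⟩
  have hcl₁ := mem_closure (hb.subset_ground (by simp)) hb₁ hd₁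
  have hcl₂ := mem_closure (hb.subset_ground (by simp)) hb₂ hd₂
  simp only [union_singleton, ← hP.mem_fundCircuit_iff hcl₁ hb₁, ← hP.mem_fundCircuit_iff hcl₂ hb₂]
  obtain ⟨c, hcP, hc₁⟩ := hP.exists_mem_fundCircuit hb₁ (hb.subset (by simp)) hcl₁
  obtain ⟨d, hdP, hdc⟩ := hP.exists_mem_fundCircuit hb₂ (hb.subset (by simp)) hcl₂
  by_contra! h
  -- Both fundamental circuits meet `P` in exactly `{c}`, so eliminating `c` gives a circuit
  -- inside `{b₁, b₂}`.
  have hsub₁ := M.fundCircuit_subset_insert b₁ P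
  have hsub₂ := M.fundCircuit_subset_insert b₂ P
  have hC : M.fundCircuit b₁ P ≠ M.fundCircuit b₂ P := by
    intro heq
    rcases hsub₂ (heq ▸ M.mem_fundCircuit b₁ P) with h' | h'
    · exact hne h'
    · exact hb₁ h'
  obtain ⟨C, hCss, hCc⟩ := (hP.fundCircuit_isCircuit hcl₁ hb₁).elimination
    (hP.fundCircuit_isCircuit hcl₂ hb₂) hC c
  refine hCc.not_indep (hb.subset fun x hx => ?_)
  obtain ⟨hx₁ | hx₂, hxc⟩ := hCss hx
  · rcases hsub₁ hx₁ with hxb | hxP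
    · exact Or.inl hxb
    · grind
  · rcases hsub₂ hx₂ with hxb | hxP
    · exact Or.inr hxb
    · grind
end
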